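/- There is an absolute constant B ≥ 0 such that for all reals C ≥ 0 and D ≥ 0 there is a constant K = K(C,D) > 0 with the following property: for all integers a ≥ 1 and t ≥ 0 and all reals m ≥ 2 and N ≥ 3m with t ≤ D log(N/m), Σ_{j ≤ m, ω(j) = a} (log log(N/j) + C)^t ≤ K · m · (log log m + B)^{a−1} · (log log(N/m) + C)^t / ((a−1)! · log m), where the sum is over integers j. -/

import Mathlib

open Finset

/-- Splitting off the prime-power components of the integers with `a + 1` prime factors. -/
theorem sum_primeFactors_ordProj_ordCompl_le (X a : ℕ) (F : ℕ → ℕ → ℝ) (hF : ∀ q n, 0 ≤ F q n) :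
    ∑ j ∈ Icc 1 X with j.primeFactors.card = a + 1,
        ∑ p ∈ j.primeFactors, F (p ^ j.factorization p) (j / p ^ j.factorization p) ≤
      ∑ n ∈ Icc 1 X with n.primeFactors.card = a,
        ∑ q ∈ Icc 1 (X / n) with IsPrimePow q, F q n := by
  rw [sum_sigma', sum_sigma']
  let g : (Σ _ : ℕ, ℕ) → (Σ _ : ℕ, ℕ) :=
    fun x => ⟨x.1 / x.2 ^ x.1.factorization x.2, x.2 ^ x.1.factorization x.2⟩
  rw [← sum_image (s := ((Icc 1 X).filter fun j => j.primeFactors.card = a + 1).sigma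
    fun j => j.primeFactors) (g := g) (f := fun y => F y.2 y.1)]
  · refine sum_le_sum_of_subset_of_nonneg ?_ fun _ _ _ => hF _ _
    intro y hy
    simp only [mem_image, mem_sigma, mem_filter, mem_Icc] at hy
    obtain ⟨⟨j, p⟩, ⟨⟨⟨hj1, hjX⟩, hja⟩, hp⟩, rfl⟩ := hy
    have hpp := Nat.prime_of_mem_primeFactors hp
    have hj0 : j ≠ 0 := by dsimp only at hj1; omega
    have hv : j.factorization p ≠ 0 := by
      rw [← Finsupp.mem_support_iff, Nat.support_factorization]; exact hp
    have hmul := Nat.ordProj_mul_ordCompl_eq_self j p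
    have hpos := Nat.ordCompl_pos p hj0
    have hqpos : 0 < p ^ j.factorization p := pow_pos hpp.pos _
    simp only [g, mem_sigma, mem_filter, mem_Icc]
    refine ⟨⟨⟨hpos, (Nat.div_le_self _ _).trans hjX⟩, ?_⟩, ⟨hqpos, ?_⟩, hpp.isPrimePow.pow hv⟩
    · rw [← Nat.support_factorization, Nat.factorization_ordCompl, Finsupp.support_erase,
        Nat.support_factorization, card_erase_of_mem hp, hja]; rfl
    · rw [Nat.le_div_iff_mul_le hpos, hmul]; exact hjX
  · rintro ⟨j, p⟩ hjp ⟨j', p'⟩ hjp' h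
    simp only [coe_sigma, Set.mem_sigma_iff, mem_coe, mem_filter, mem_Icc] at hjp hjp'
    simp only [g, Sigma.mk.injEq, heq_eq_eq] at h
    obtain ⟨h1, h2⟩ := h
    have e : j = j' := by
      rw [← Nat.ordProj_mul_ordCompl_eq_self j p, h1, h2, Nat.ordProj_mul_ordCompl_eq_self]
    have hpp := Nat.prime_of_mem_primeFactors hjp.2
    have hpp' := Nat.prime_of_mem_primeFactors hjp'.2
    have hv : j.factorization p ≠ 0 := by
      rw [← Finsupp.mem_support_iff, Nat.support_factorization]; exact hjp.2
    have hv' : j'.factorization p' ≠ 0 := by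
      rw [← Finsupp.mem_support_iff, Nat.support_factorization]; exact hjp'.2
    have ep : p = p' := by
      rw [← hpp.pow_minFac hv, h2, hpp'.pow_minFac hv']
    subst e ep; rfl

/-- The reciprocals of the integers with `a` prime factors sum to at most `Q ^ a / a!`, where `Q` is
the sum of the reciprocals of the prime powers. -/
theorem sum_inv_card_primeFactors_le (X a : ℕ) :
    ∑ n ∈ Icc 1 X with n.primeFactors.card = a, (n : ℝ)⁻¹ ≤
      (∑ q ∈ Icc 1 X with IsPrimePow q, (q : ℝ)⁻¹) ^ a / (a.factorial : ℝ) := by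
  induction a with
  | zero =>
    simp only [pow_zero, Nat.factorial_zero, Nat.cast_one, div_one]
    calc _ ≤ ∑ n ∈ ({1} : Finset ℕ), (n : ℝ)⁻¹ := by
          refine sum_le_sum_of_subset_of_nonneg ?_ fun _ _ _ => by positivity
          intro n hn
          simp only [mem_filter, mem_Icc, card_eq_zero, Nat.primeFactors_eq_empty] at hn
          simp; omega
      _ = 1 := by simp
  | succ a ih =>
    set Q := ∑ q ∈ Icc 1 X with IsPrimePow q, (q : ℝ)⁻¹
    have hQ : 0 ≤ Q := sum_nonneg fun _ _ => by positivity
    have key := sum_primeFactors_ordProj_ordCompl_le X a (fun q n => (q : ℝ)⁻¹ * (n : ℝ)⁻¹)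
      fun _ _ => by positivity
    have hl : ∑ j ∈ Icc 1 X with j.primeFactors.card = a + 1, ∑ p ∈ j.primeFactors,
        ((p ^ j.factorization p : ℕ) : ℝ)⁻¹ * ((j / p ^ j.factorization p : ℕ) : ℝ)⁻¹ =
        ((a : ℝ) + 1) * ∑ n ∈ Icc 1 X with n.primeFactors.card = a + 1, (n : ℝ)⁻¹ := by
      rw [mul_sum]
      refine sum_congr rfl fun j hj => ?_
      have : ∀ p ∈ j.primeFactors, ((p ^ j.factorization p : ℕ) : ℝ)⁻¹ *
          ((j / p ^ j.factorization p : ℕ) : ℝ)⁻¹ = (j : ℝ)⁻¹ := fun p _ => by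
        rw [← mul_inv, ← Nat.cast_mul, Nat.ordProj_mul_ordCompl_eq_self]
      rw [sum_congr rfl this, sum_const, (mem_filter.1 hj).2]
      simp
    rw [hl] at key
    have hr : ∑ n ∈ Icc 1 X with n.primeFactors.card = a, ∑ q ∈ Icc 1 (X / n) with IsPrimePow q,
        (q : ℝ)⁻¹ * (n : ℝ)⁻¹ ≤ Q * (Q ^ a / (a.factorial : ℝ)) := by
      refine le_trans ?_ (mul_le_mul_of_nonneg_left ih hQ)
      rw [mul_sum]
      refine sum_le_sum fun n _ => ?_
      rw [← sum_mul]
      refine mul_le_mul_of_nonneg_right ?_ (by positivity)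
      refine sum_le_sum_of_subset_of_nonneg ?_ fun _ _ _ => by positivity
      exact filter_subset_filter _ (Icc_subset_Icc_right (Nat.div_le_self _ _))
    rw [Nat.factorial_succ, le_div_iff₀ (by positivity)]
    have := key.trans hr
    rw [mul_div_assoc', le_div_iff₀ (by positivity)] at this
    push_cast
    calc _ = ((a : ℝ) + 1) * (∑ n ∈ Icc 1 X with n.primeFactors.card = a + 1, (n : ℝ)⁻¹) *
          (a.factorial : ℝ) := by ring
      _ ≤ _ := this.trans_eq (by ring)

theorem sum_log_le_of_primes (N : ℕ) :
    ∑ p ∈ Icc 1 N with p.Prime, Real.log p ≤ Real.log 4 * N := by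
  have := Chebyshev.theta_le_log4_mul_x (x := N) (by positivity)
  rwa [Chebyshev.theta, Nat.floor_natCast] at this

/-- The upper bound in the first theorem of Mertens. -/
theorem sum_log_div_prime_le {N : ℕ} (hN : 1 ≤ N) :
    ∑ p ∈ Icc 1 N with p.Prime, Real.log p / p ≤ Real.log N + Real.log 4 := by
  have hN0 : (0 : ℝ) < N := by exact_mod_cast hN
  have h1 : ∑ p ∈ Icc 1 N with p.Prime, Real.log p * (N / p : ℕ) ≤ N * Real.log N := by
    have e : ∀ p ∈ (Icc 1 N).filter Nat.Prime, Real.log p * (N / p : ℕ) =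
        ∑ n ∈ Icc 1 N, if p ∣ n then Real.log p else 0 := fun p _ => by
      rw [← sum_filter, sum_const, nsmul_eq_mul, mul_comm]
      congr 2
      exact (Nat.Ioc_filter_dvd_card_eq_div N p).symm
    rw [sum_congr rfl e, sum_comm]
    calc _ ≤ ∑ n ∈ Icc 1 N, Real.log N := by
          refine sum_le_sum fun n hn => ?_
          obtain ⟨hn1, hnN⟩ := mem_Icc.1 hn
          rw [← sum_filter]
          have es : ((Icc 1 N).filter Nat.Prime).filter (· ∣ n) = n.primeFactors := by
            ext p
            simp only [mem_filter, mem_Icc, Nat.mem_primeFactors]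
            constructor
            · rintro ⟨⟨_, h⟩, h'⟩; exact ⟨h, h', by omega⟩
            · rintro ⟨h, h', _⟩
              exact ⟨⟨⟨h.one_lt.le, (Nat.le_of_dvd hn1 h').trans hnN⟩, h⟩, h'⟩
          rw [es, ← Real.log_prod fun p hp => by
            exact_mod_cast (Nat.prime_of_mem_primeFactors hp).ne_zero]
          have hle : ∏ p ∈ n.primeFactors, p ≤ N :=
            (Nat.le_of_dvd hn1 (Nat.prod_primeFactors_dvd n)).trans hnN
          rw [← Nat.cast_prod]
          refine Real.log_le_log ?_ (Nat.cast_le.2 hle)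
          rw [Nat.cast_prod]
          exact prod_pos fun p hp => by exact_mod_cast (Nat.prime_of_mem_primeFactors hp).pos
      _ = N * Real.log N := by simp
  have h2 := sum_log_le_of_primes N
  have h3 : N * ∑ p ∈ Icc 1 N with p.Prime, Real.log p / p ≤
      ∑ p ∈ Icc 1 N with p.Prime, (Real.log p * (N / p : ℕ) + Real.log p) := by
    rw [mul_sum]
    refine sum_le_sum fun p hp => ?_
    have hp0 : 0 < p := (mem_filter.1 hp).2.pos
    have hlog : 0 ≤ Real.log p := Real.log_natCast_nonneg p
    have : (N : ℝ) / p ≤ (N / p : ℕ) + 1 := by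
      rw [← Nat.floor_div_eq_div (K := ℝ)]; exact (Nat.lt_floor_add_one _).le
    calc _ = Real.log p * ((N : ℝ) / p) := by ring
      _ ≤ Real.log p * ((N / p : ℕ) + 1) := by gcongr
      _ = _ := by ring
  rw [sum_add_distrib] at h3
  refine le_of_mul_le_mul_left ?_ hN0
  linarith

theorem one_sub_log_div_log_le {x y : ℝ} (hx : 1 < x) (hy : 1 < y) :
    1 - Real.log x / Real.log y ≤ Real.log (Real.log y) - Real.log (Real.log x) := by
  have hx' := Real.log_pos hx
  have hy' := Real.log_pos hy
  have := Real.log_le_sub_one_of_pos (div_pos hx' hy')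
  rw [Real.log_div hx'.ne' hy'.ne'] at this
  linarith

/-- The upper bound in the second theorem of Mertens. -/
theorem exists_sum_inv_prime_le :
    ∃ B : ℝ, ∀ N : ℕ, 2 ≤ N →
      ∑ p ∈ Icc 1 N with p.Prime, (p : ℝ)⁻¹ ≤ Real.log (Real.log N) + B := by
  set M : ℕ → ℝ := fun N => ∑ p ∈ Icc 1 N with p.Prime, Real.log p / p with hM
  set P : ℕ → ℝ := fun N => ∑ p ∈ Icc 1 N with p.Prime, (p : ℝ)⁻¹ with hP
  set c := Real.log 4
  set G : ℕ → ℝ := fun N => P N - M N / Real.log N - Real.log (Real.log N) + c / Real.log N with hG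
  have hstep : ∀ N : ℕ, 2 ≤ N → G (N + 1) ≤ G N := fun N hN => by
    have hN1 : (1 : ℝ) < N := by exact_mod_cast hN
    have hN2 : (1 : ℝ) < (N + 1 : ℕ) := by push_cast; linarith
    have l1 := Real.log_pos hN1
    have l2 := Real.log_pos hN2
    have hlog : Real.log N ≤ Real.log (N + 1 : ℕ) :=
      Real.log_le_log (by linarith) (by push_cast; linarith)
    have hd : P (N + 1) - M (N + 1) / Real.log (N + 1 : ℕ) = P N - M N / Real.log (N + 1 : ℕ) := by
      simp only [hP, hM]
      rw [← insert_Icc_right_eq_Icc_add_one (by omega), filter_insert]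
      split_ifs
      · rw [sum_insert (by simp), sum_insert (by simp)]
        field_simp
        ring
      · rfl
    have hMN : M N ≤ Real.log N + c := sum_log_div_prime_le (by omega)
    have hinv : 0 ≤ (Real.log N)⁻¹ - (Real.log (N + 1 : ℕ))⁻¹ :=
      sub_nonneg.2 (inv_anti₀ l1 hlog)
    have h1 := mul_le_mul_of_nonneg_right hMN hinv
    have h2 := one_sub_log_div_log_le hN1 hN2
    have h3 : Real.log N * (Real.log N)⁻¹ = 1 := mul_inv_cancel₀ l1.ne'
    simp only [hG, div_eq_mul_inv] at *
    nlinarith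
  have hG2 : ∀ N : ℕ, 2 ≤ N → G N ≤ G 2 := fun N hN => by
    induction N, hN using Nat.le_induction with
    | base => rfl
    | succ N hN ih => exact (hstep N hN).trans ih
  refine ⟨G 2 + 1, fun N hN => ?_⟩
  have h := hG2 N hN
  have l1 : 0 < Real.log N := Real.log_pos (by exact_mod_cast hN)
  have hMN : M N ≤ Real.log N + c := sum_log_div_prime_le (by omega)
  have : M N / Real.log N ≤ 1 + c / Real.log N := by
    rw [div_le_iff₀ l1, add_mul, div_mul_cancel₀ _ l1.ne']; linarith
  simp only [hG] at h
  change P N ≤ _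
  simp only [hG]
  linarith

theorem exists_sum_nonprime_isPrimePow_le :
    ∃ c : ℝ, ∀ N : ℕ,
      ∑ q ∈ Icc 1 N with IsPrimePow q ∧ ¬ q.Prime, (q : ℝ) ^ (-(5 / 8) : ℝ) ≤ c := by
  let h : ℕ × ℕ → ℝ := fun x => (((x.1 + 2) ^ (x.2 + 2) : ℕ) : ℝ) ^ (-(5 / 8) : ℝ)
  have hs1 : Summable fun n : ℕ => ((n + 2 : ℕ) : ℝ) ^ (-(5 / 4) : ℝ) :=
    (summable_nat_add_iff 2).2 (Real.summable_nat_rpow.2 (by norm_num))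
  have hr : (2 : ℝ) ^ (-(5 / 8) : ℝ) < 1 :=
    Real.rpow_lt_one_of_one_lt_of_neg (by norm_num) (by norm_num)
  have hs2 : Summable fun k : ℕ => ((2 : ℝ) ^ (-(5 / 8) : ℝ)) ^ k :=
    summable_geometric_of_lt_one (by positivity) hr
  have hs : Summable h := by
    refine (hs1.mul_of_nonneg hs2 (fun _ => by positivity) fun _ => by positivity).of_nonneg_of_le
      (fun _ => by positivity) fun ⟨n, k⟩ => ?_
    have hn : (0 : ℝ) ≤ (n + 2 : ℕ) := by positivity
    have e : h (n, k) = ((n + 2 : ℕ) : ℝ) ^ (-(5 / 4) : ℝ) *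
        (((n + 2 : ℕ) : ℝ) ^ (-(5 / 8) : ℝ)) ^ k := by
      simp only [h]
      rw [Nat.cast_pow, ← Real.rpow_natCast, ← Real.rpow_mul hn, ← Real.rpow_natCast,
        ← Real.rpow_mul hn, ← Real.rpow_add (by positivity)]
      congr 1
      push_cast
      ring
    rw [e]
    refine mul_le_mul_of_nonneg_left ?_ (by positivity)
    refine pow_le_pow_left₀ (by positivity) ?_ k
    exact Real.rpow_le_rpow_of_nonpos (by norm_num) (by push_cast; linarith [n.cast_nonneg (α := ℝ)])
      (by norm_num)
  have hex : ∀ q : ℕ, IsPrimePow q ∧ ¬ q.Prime → ∃ x : ℕ × ℕ, (x.1 + 2) ^ (x.2 + 2) = q := by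
    rintro q ⟨hq, hq'⟩
    obtain ⟨p, k, hp, hk, rfl⟩ := (isPrimePow_nat_iff q).1 hq
    have h2 := hp.two_le
    have hk1 : k ≠ 1 := by rintro rfl; exact hq' (by simpa using hp)
    exact ⟨(p - 2, k - 2), by simp only; congr 1 <;> omega⟩
  choose! g hg using hex
  refine ⟨∑' x, h x, fun N => ?_⟩
  have e : ∀ q ∈ (Icc 1 N).filter (fun q => IsPrimePow q ∧ ¬ q.Prime),
      (q : ℝ) ^ (-(5 / 8) : ℝ) = h (g q) := fun q hq => by
    simp only [h]; rw [hg q (mem_filter.1 hq).2]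
  rw [sum_congr rfl e, ← sum_image (f := h) (g := g)]
  · exact hs.sum_le_tsum _ fun _ _ => by positivity
  · intro q hq q' hq' heq
    rw [← hg q (mem_filter.1 hq).2, ← hg q' (mem_filter.1 hq').2, heq]

theorem sum_isPrimePow_eq (N : ℕ) (f : ℕ → ℝ) :
    ∑ q ∈ Icc 1 N with IsPrimePow q, f q =
      ∑ p ∈ Icc 1 N with p.Prime, f p + ∑ q ∈ Icc 1 N with IsPrimePow q ∧ ¬ q.Prime, f q := by
  rw [← sum_filter_add_sum_filter_not _ Nat.Prime, filter_filter, filter_filter]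
  congr 2
  ext q
  simp only [mem_filter, and_congr_right_iff, and_iff_right_iff_imp]
  exact fun _ h => h.isPrimePow

theorem exists_sum_inv_isPrimePow_le :
    ∃ B ≥ (0 : ℝ), ∀ N : ℕ, 2 ≤ N →
      ∑ q ∈ Icc 1 N with IsPrimePow q, (q : ℝ)⁻¹ ≤ Real.log (Real.log N) + B := by
  obtain ⟨B, hB⟩ := exists_sum_inv_prime_le
  obtain ⟨c, hc⟩ := exists_sum_nonprime_isPrimePow_le
  refine ⟨max (B + c) 0, le_max_right _ _, fun N hN => ?_⟩
  rw [sum_isPrimePow_eq]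
  have h1 := hB N hN
  have h2 : ∑ q ∈ Icc 1 N with IsPrimePow q ∧ ¬ q.Prime, (q : ℝ)⁻¹ ≤ c := by
    refine le_trans (sum_le_sum fun q hq => ?_) (hc N)
    rw [← Real.rpow_neg_one]
    refine Real.rpow_le_rpow_of_exponent_le ?_ (by norm_num)
    exact_mod_cast (mem_Icc.1 (mem_filter.1 hq).1).1
  linarith [le_max_left (B + c) 0]

theorem exists_sum_log_mul_rpow_prime_le :
    ∃ A ≥ (0 : ℝ), ∀ N : ℕ,
      ∑ p ∈ Icc 1 N with p.Prime, Real.log p * (p : ℝ) ^ (-(3 / 4) : ℝ) ≤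
        A * (N : ℝ) ^ (1 / 4 : ℝ) := by
  set r : ℝ := (2 : ℝ) ^ (-(1 / 4) : ℝ) with hr_def
  set s : ℝ := (2 : ℝ) ^ (3 / 4 : ℝ) with hs_def
  have hr : r < 1 := Real.rpow_lt_one_of_one_lt_of_neg (by norm_num) (by norm_num)
  have hl4 : 0 ≤ Real.log 4 := Real.log_nonneg (by norm_num)
  have hs : 0 ≤ s := by positivity
  set A := s * Real.log 4 / (1 - r) with hA_def
  have hA : 0 ≤ A := div_nonneg (mul_nonneg hs hl4) (by linarith)
  have hAeq : A * r + s * Real.log 4 = A := by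
    have : (1 - r) ≠ 0 := by linarith
    rw [hA_def]; field_simp; ring
  refine ⟨A, hA, fun N => ?_⟩
  induction N using Nat.strong_induction_on with
  | _ N ih =>
    rcases Nat.eq_zero_or_pos N with rfl | hN
    · simp
    have hN0 : (0 : ℝ) < N := by exact_mod_cast hN
    have h1 := ih (N / 2) (by omega)
    have hterm : ∀ p ∈ (Icc 1 N).filter Nat.Prime, Real.log p * (p : ℝ) ^ (-(3 / 4) : ℝ) ≤
        (if p ∈ (Icc 1 (N / 2)) then Real.log p * (p : ℝ) ^ (-(3 / 4) : ℝ) else 0) +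
          Real.log p * ((N : ℝ) / 2) ^ (-(3 / 4) : ℝ) := fun p hp => by
      have hlog : 0 ≤ Real.log p := Real.log_natCast_nonneg p
      split_ifs with h
      · exact le_add_of_nonneg_right (by positivity)
      · rw [zero_add]
        refine mul_le_mul_of_nonneg_left ?_ hlog
        refine Real.rpow_le_rpow_of_nonpos (by positivity) ?_ (by norm_num)
        have h1p := (mem_Icc.1 (mem_filter.1 hp).1).1
        have : N ≤ p * 2 := by rw [mem_Icc] at h; omega
        rw [div_le_iff₀ two_pos]
        exact_mod_cast this
    refine (sum_le_sum hterm).trans ?_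
    rw [sum_add_distrib, ← sum_mul, ← sum_filter]
    have es : ((Icc 1 N).filter Nat.Prime).filter (· ∈ Icc 1 (N / 2)) =
        (Icc 1 (N / 2)).filter Nat.Prime := by
      ext p; simp only [mem_filter, mem_Icc]
      constructor
      · tauto
      · rintro ⟨⟨a, b⟩, c⟩; exact ⟨⟨⟨a, by omega⟩, c⟩, a, b⟩
    rw [es]
    have h2 : ((N / 2 : ℕ) : ℝ) ^ (1 / 4 : ℝ) ≤ r * (N : ℝ) ^ (1 / 4 : ℝ) := by
      calc _ ≤ ((N : ℝ) / 2) ^ (1 / 4 : ℝ) :=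
            Real.rpow_le_rpow (by positivity) Nat.cast_div_le (by norm_num)
        _ = _ := by
            rw [Real.div_rpow hN0.le (by norm_num), hr_def, Real.rpow_neg (by norm_num)]; ring
    have h3 : (∑ p ∈ Icc 1 N with p.Prime, Real.log p) * ((N : ℝ) / 2) ^ (-(3 / 4) : ℝ) ≤
        s * Real.log 4 * (N : ℝ) ^ (1 / 4 : ℝ) := by
      have e : ((N : ℝ) / 2) ^ (-(3 / 4) : ℝ) = s * (N : ℝ) ^ (-(3 / 4) : ℝ) := by
        rw [Real.div_rpow hN0.le (by norm_num), hs_def, Real.rpow_neg (x := 2) (by norm_num),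
          div_inv_eq_mul, mul_comm]
      have e' : (N : ℝ) ^ (1 / 4 : ℝ) = N * (N : ℝ) ^ (-(3 / 4) : ℝ) := by
        rw [← Real.rpow_one_add' hN0.le (by norm_num)]; norm_num
      rw [e, e']
      calc _ ≤ (Real.log 4 * N) * (s * (N : ℝ) ^ (-(3 / 4) : ℝ)) :=
            mul_le_mul_of_nonneg_right (sum_log_le_of_primes N) (by positivity)
        _ = _ := by ring
    have h4 := mul_le_mul_of_nonneg_left h2 hA
    calc _ ≤ A * (r * (N : ℝ) ^ (1 / 4 : ℝ)) + s * Real.log 4 * (N : ℝ) ^ (1 / 4 : ℝ) :=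
          add_le_add (h1.trans h4) h3
      _ = (A * r + s * Real.log 4) * (N : ℝ) ^ (1 / 4 : ℝ) := by ring
      _ = _ := by rw [hAeq]

theorem exists_sum_log_mul_rpow_isPrimePow_le :
    ∃ A ≥ (0 : ℝ), ∀ N : ℕ,
      ∑ q ∈ Icc 1 N with IsPrimePow q, Real.log q * (q : ℝ) ^ (-(3 / 4) : ℝ) ≤
        A * (N : ℝ) ^ (1 / 4 : ℝ) := by
  obtain ⟨A, hA, h⟩ := exists_sum_log_mul_rpow_prime_le
  obtain ⟨c, hc⟩ := exists_sum_nonprime_isPrimePow_le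
  have hc0 : 0 ≤ c := by simpa using hc 0
  refine ⟨A + 8 * c, by positivity, fun N => ?_⟩
  rcases Nat.eq_zero_or_pos N with rfl | hN
  · simp
  rw [sum_isPrimePow_eq, add_mul]
  refine add_le_add (h N) ?_
  have h1 : ∑ q ∈ Icc 1 N with IsPrimePow q ∧ ¬ q.Prime,
      Real.log q * (q : ℝ) ^ (-(3 / 4) : ℝ) ≤ 8 * c := by
    refine le_trans ?_ (mul_le_mul_of_nonneg_left (hc N) (by norm_num))
    rw [mul_sum]
    refine sum_le_sum fun q hq => ?_
    have hq0 : (0 : ℝ) < q := by exact_mod_cast (mem_Icc.1 (mem_filter.1 hq).1).1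
    have hl := Real.log_le_rpow_div hq0.le (ε := 1 / 8) (by norm_num)
    calc _ ≤ ((q : ℝ) ^ (1 / 8 : ℝ) / (1 / 8)) * (q : ℝ) ^ (-(3 / 4) : ℝ) :=
          mul_le_mul_of_nonneg_right hl (by positivity)
      _ = 8 * ((q : ℝ) ^ (1 / 8 : ℝ) * (q : ℝ) ^ (-(3 / 4) : ℝ)) := by ring
      _ = _ := by rw [← Real.rpow_add hq0]; norm_num
  refine h1.trans (le_mul_of_one_le_right (by positivity) ?_)
  exact Real.one_le_rpow (by exact_mod_cast hN) (by norm_num)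

theorem exists_sum_rpow_card_primeFactors_le :
    ∃ A ≥ (0 : ℝ), ∀ (a : ℕ) (m : ℝ), 2 ≤ m →
      (∑ j ∈ Icc 1 ⌊m⌋₊ with j.primeFactors.card = a + 1, (m / j) ^ (1 / 2 : ℝ)) * Real.log m ≤
        A * m * ((∑ q ∈ Icc 1 ⌊m⌋₊ with IsPrimePow q, (q : ℝ)⁻¹) ^ a / (a.factorial : ℝ)) := by
  obtain ⟨A, hA, h⟩ := exists_sum_log_mul_rpow_isPrimePow_le
  have hl2 : 0 < Real.log 2 := Real.log_pos (by norm_num)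
  refine ⟨(1 + 4 / Real.log 2) * A, by positivity, fun a m hm => ?_⟩
  have hm0 : 0 < m := by linarith
  set X := ⌊m⌋₊
  set F : ℕ → ℕ → ℝ := fun q n => Real.log q * (m / (q * n : ℕ)) ^ (3 / 4 : ℝ) with hF
  have hF0 : ∀ q n, 0 ≤ F q n := fun q n =>
    mul_nonneg (Real.log_natCast_nonneg q) (by positivity)
  have hj : ∀ j ∈ (Icc 1 X).filter (fun j => j.primeFactors.card = a + 1),
      (m / j) ^ (1 / 2 : ℝ) * Real.log m ≤ (1 + 4 / Real.log 2) *
        ∑ p ∈ j.primeFactors, F (p ^ j.factorization p) (j / p ^ j.factorization p) := by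
    intro j hj
    obtain ⟨hj, hja⟩ := mem_filter.1 hj
    obtain ⟨hj1, hjX⟩ := mem_Icc.1 hj
    have hj2 : 2 ≤ j := by
      by_contra hlt
      obtain rfl : j = 1 := by omega
      simp at hja
    have hj0 : (0 : ℝ) < j := by exact_mod_cast hj1
    have hjm : (j : ℝ) ≤ m := (Nat.le_floor_iff hm0.le).1 hjX
    have hlog : ∑ p ∈ j.primeFactors, F (p ^ j.factorization p) (j / p ^ j.factorization p) =
        Real.log j * (m / j) ^ (3 / 4 : ℝ) := by
      simp only [hF, Nat.ordProj_mul_ordCompl_eq_self]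
      rw [← sum_mul, ← Real.log_prod fun p hp => by
        exact_mod_cast (pow_pos (Nat.prime_of_mem_primeFactors hp).pos _).ne', ← Nat.cast_prod]
      have hp : ∏ p ∈ j.primeFactors, p ^ j.factorization p = j :=
        Nat.prod_factorization_pow_eq_self (by omega)
      rw [hp]
    rw [hlog]
    have hx1 : 1 ≤ m / j := (one_le_div hj0).2 hjm
    have hx0 : 0 < m / j := by linarith
    have hlj : Real.log 2 ≤ Real.log j := Real.log_le_log two_pos (by exact_mod_cast hj2)
    have hlx := Real.log_le_rpow_div hx0.le (ε := 1 / 4) (by norm_num)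
    have h1x : 1 ≤ (m / j) ^ (1 / 4 : ℝ) := Real.one_le_rpow hx1 (by norm_num)
    have hlm : Real.log m = Real.log j + Real.log (m / j) := by
      rw [Real.log_div hm0.ne' hj0.ne']; ring
    have hlm' : Real.log m ≤ (1 + 4 / Real.log 2) * Real.log j * (m / j) ^ (1 / 4 : ℝ) := by
      have h1 : Real.log j ≤ Real.log j * (m / j) ^ (1 / 4 : ℝ) :=
        le_mul_of_one_le_right (by linarith) h1x
      have h2 : 4 ≤ 4 / Real.log 2 * Real.log j := by
        rw [div_mul_eq_mul_div, le_div_iff₀ hl2]; linarith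
      have h3 := mul_le_mul_of_nonneg_right h2 (by linarith : 0 ≤ (m / j) ^ (1 / 4 : ℝ))
      linarith
    calc _ ≤ (m / j) ^ (1 / 2 : ℝ) *
          ((1 + 4 / Real.log 2) * Real.log j * (m / j) ^ (1 / 4 : ℝ)) :=
          mul_le_mul_of_nonneg_left hlm' (by positivity)
      _ = (1 + 4 / Real.log 2) *
          (Real.log j * ((m / j) ^ (1 / 2 : ℝ) * (m / j) ^ (1 / 4 : ℝ))) := by ring
      _ = _ := by rw [← Real.rpow_add hx0]; norm_num
  rw [sum_mul]
  refine (sum_le_sum hj).trans ?_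
  rw [← mul_sum, mul_assoc, mul_assoc]
  refine mul_le_mul_of_nonneg_left ?_ (by positivity)
  refine (sum_primeFactors_ordProj_ordCompl_le X a F hF0).trans ?_
  rw [← mul_assoc]
  refine le_trans ?_
    (mul_le_mul_of_nonneg_left (sum_inv_card_primeFactors_le X a) (mul_nonneg hA hm0.le))
  rw [mul_sum]
  refine sum_le_sum fun n hn => ?_
  have hn0 : (0 : ℝ) < n := by exact_mod_cast (mem_Icc.1 (mem_filter.1 hn).1).1
  have hmn : 0 < m / n := by positivity
  have hq : ∀ q ∈ (Icc 1 (X / n)).filter IsPrimePow,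
      F q n = (m / n) ^ (3 / 4 : ℝ) * (Real.log q * (q : ℝ) ^ (-(3 / 4) : ℝ)) := fun q hq => by
    have hq0 : (0 : ℝ) < q := by exact_mod_cast (mem_Icc.1 (mem_filter.1 hq).1).1
    have : m / (q * n : ℕ) = (m / n) / q := by push_cast; field_simp
    simp only [hF]
    rw [this, Real.div_rpow hmn.le hq0.le, Real.rpow_neg hq0.le]
    ring
  rw [sum_congr rfl hq, ← mul_sum]
  have hXn : ((X / n : ℕ) : ℝ) ≤ m / n :=
    Nat.cast_div_le.trans (by gcongr; exact Nat.floor_le hm0.le)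
  calc _ ≤ (m / n) ^ (3 / 4 : ℝ) * (A * (m / n) ^ (1 / 4 : ℝ)) := by
        refine mul_le_mul_of_nonneg_left ((h _).trans ?_) (by positivity)
        exact mul_le_mul_of_nonneg_left
          (Real.rpow_le_rpow (by positivity) hXn (by norm_num)) hA
    _ = A * ((m / n) ^ (3 / 4 : ℝ) * (m / n) ^ (1 / 4 : ℝ)) := by ring
    _ = A * (m / n) := by rw [← Real.rpow_add hmn]; norm_num
    _ = _ := by ring

theorem one_lt_log_three : 1 < Real.log 3 := by
  rw [Real.lt_log_iff_exp_lt (by norm_num)]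
  linarith [Real.exp_one_lt_d9]

theorem exists_log_add_pow_le (C D : ℝ) (hC : 0 ≤ C) :
    ∃ K > (0 : ℝ), ∀ (t : ℕ) (u v : ℝ), Real.log 3 ≤ u → 0 ≤ v → (t : ℝ) ≤ D * u →
      (Real.log (u + v) + C) ^ t ≤ K * Real.exp (v / 2) * (Real.log u + C) ^ t := by
  have h3 := one_lt_log_three
  set δ := Real.log (Real.log 3)
  have hδ : 0 < δ := Real.log_pos h3
  set T := ⌈D * Real.exp (2 * D)⌉₊
  set κ : ℝ := max 1 (2 * (T + 1) / δ)
  have hκ1 : 1 ≤ κ := le_max_left _ _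
  have hκ2 : 2 * (T + 1) / δ ≤ κ := le_max_right _ _
  have hκT : 1 ≤ κ ^ T := one_le_pow₀ hκ1
  refine ⟨κ ^ T, by positivity, fun t u v hu hv ht => ?_⟩
  have hu1 : 1 < u := by linarith
  have hu0 : 0 < u := by linarith
  set L := Real.log u + C with hL_def
  have hL : δ ≤ L := by
    have : δ ≤ Real.log u := Real.log_le_log (by linarith) hu
    linarith
  have hL0 : 0 < L := by linarith
  have hbase : Real.log (u + v) + C ≤ (1 + v / (u * L)) * L := by
    have h1 := Real.log_le_sub_one_of_pos (show 0 < (u + v) / u by positivity)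
    rw [Real.log_div (by positivity) hu0.ne'] at h1
    have h2 : (u + v) / u - 1 = v / u := by field_simp; ring
    have h4 : (1 + v / (u * L)) * L = L + v / u := by field_simp
    rw [h4, hL_def]
    linarith
  have hbase0 : 0 ≤ Real.log (u + v) + C :=
    add_nonneg (Real.log_nonneg (by linarith)) hC
  refine (pow_le_pow_left₀ hbase0 hbase t).trans ?_
  rw [mul_pow]
  refine mul_le_mul_of_nonneg_right ?_ (by positivity)
  rcases le_or_gt (2 * D) (Real.log u) with hD | hD
  · calc (1 + v / (u * L)) ^ t ≤ Real.exp (v / (u * L)) ^ t := by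
          refine pow_le_pow_left₀ (by positivity) ?_ t
          rw [add_comm]; exact Real.add_one_le_exp _
      _ = Real.exp (t * (v / (u * L))) := (Real.exp_nat_mul _ _).symm
      _ ≤ Real.exp (v / 2) := by
          refine Real.exp_le_exp.2 ?_
          calc (t : ℝ) * (v / (u * L)) ≤ (L / 2 * u) * (v / (u * L)) := by
                refine mul_le_mul_of_nonneg_right (ht.trans ?_) (by positivity)
                refine mul_le_mul_of_nonneg_right ?_ hu0.le
                linarith
            _ = v / 2 := by field_simp
      _ ≤ _ := le_mul_of_one_le_left (Real.exp_pos _).le hκT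
  · have htT : t ≤ T := by
      have hD0 : 0 ≤ D := by linarith [Real.log_pos hu1]
      have h1 : u ≤ Real.exp (2 * D) := ((Real.log_lt_iff_lt_exp hu0).1 hD).le
      have : (t : ℝ) ≤ T :=
        (ht.trans (mul_le_mul_of_nonneg_left h1 hD0)).trans (Nat.le_ceil _)
      exact_mod_cast this
    have h1 : 1 + v / (u * L) ≤ κ * Real.exp (v / (2 * (T + 1))) := by
      have h2 : v / (u * L) ≤ v / δ := by
        refine div_le_div_of_nonneg_left hv hδ ?_
        nlinarith
      have h4 : v / δ = 2 * (T + 1) / δ * (v / (2 * (T + 1))) := by field_simp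
      have h5 : v / δ ≤ κ * (v / (2 * (T + 1))) := by
        rw [h4]; exact mul_le_mul_of_nonneg_right hκ2 (by positivity)
      have h6 := mul_le_mul_of_nonneg_left (Real.add_one_le_exp (v / (2 * (T + 1))))
        (by linarith : 0 ≤ κ)
      linarith
    calc (1 + v / (u * L)) ^ t ≤ (κ * Real.exp (v / (2 * (T + 1)))) ^ t :=
          pow_le_pow_left₀ (by positivity) h1 t
      _ = κ ^ t * Real.exp (t * (v / (2 * (T + 1)))) := by rw [mul_pow, ← Real.exp_nat_mul]
      _ ≤ κ ^ T * Real.exp (v / 2) := by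
          refine mul_le_mul (pow_le_pow_right₀ hκ1 htT) (Real.exp_le_exp.2 ?_)
            (Real.exp_pos _).le (by positivity)
          have htT' : (t : ℝ) ≤ T + 1 := by exact_mod_cast htT.trans T.le_succ
          calc (t : ℝ) * (v / (2 * (T + 1))) ≤ (T + 1) * (v / (2 * (T + 1))) :=
                mul_le_mul_of_nonneg_right htT' (by positivity)
            _ = v / 2 := by field_simp

theorem stmt_13 :
    ∃ B ≥ (0 : ℝ), ∀ C D : ℝ, 0 ≤ C → 0 ≤ D → ∃ K > (0 : ℝ),
      ∀ (a t : ℕ), 1 ≤ a → ∀ m N : ℝ, 2 ≤ m → 3 * m ≤ N →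
        (t : ℝ) ≤ D * Real.log (N / m) →
        (∑ j ∈ (Finset.Icc 1 ⌊m⌋₊).filter (fun j => j.primeFactors.card = a),
          (Real.log (Real.log (N / j)) + C) ^ t)
        ≤ K * m * (Real.log (Real.log m) + B) ^ (a - 1) *
            (Real.log (Real.log (N / m)) + C) ^ t /
            (((a - 1).factorial : ℝ) * Real.log m) := by
  obtain ⟨B, hB, hQ⟩ := exists_sum_inv_isPrimePow_le
  obtain ⟨A, hA, hS⟩ := exists_sum_rpow_card_primeFactors_le
  refine ⟨B, hB, fun C D hC _ => ?_⟩
  obtain ⟨K, hK, hW⟩ := exists_log_add_pow_le C D hC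
  refine ⟨K * (A + 1), by positivity, ?_⟩
  intro a t ha m N hm hN ht
  obtain ⟨a, rfl⟩ : ∃ b, a = b + 1 := ⟨a - 1, by omega⟩
  rw [Nat.add_sub_cancel]
  have hm0 : 0 < m := by linarith
  have hN0 : 0 < N := by linarith
  have hlm : 0 < Real.log m := Real.log_pos (by linarith)
  have hu : Real.log 3 ≤ Real.log (N / m) :=
    Real.log_le_log (by norm_num) ((le_div_iff₀ hm0).2 hN)
  set W := (Real.log (Real.log (N / m)) + C) ^ t
  have hW0 : 0 ≤ W :=
    pow_nonneg (add_nonneg (Real.log_nonneg (one_lt_log_three.le.trans hu)) hC) t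
  have hj : ∀ j ∈ (Finset.Icc 1 ⌊m⌋₊).filter (fun j => j.primeFactors.card = a + 1),
      (Real.log (Real.log (N / j)) + C) ^ t ≤ K * W * (m / j) ^ (1 / 2 : ℝ) := by
    intro j hj
    obtain ⟨hj1, hjX⟩ := mem_Icc.1 (mem_filter.1 hj).1
    have hj0 : (0 : ℝ) < j := by exact_mod_cast hj1
    have hjm : (j : ℝ) ≤ m := (Nat.le_floor_iff hm0.le).1 hjX
    have h := hW t (Real.log (N / m)) (Real.log (m / j)) hu
      (Real.log_nonneg ((one_le_div hj0).2 hjm)) ht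
    have e1 : Real.log (N / m) + Real.log (m / j) = Real.log (N / j) := by
      rw [← Real.log_mul (by positivity) (by positivity), div_mul_div_cancel₀ hm0.ne']
    have e2 : Real.exp (Real.log (m / j) / 2) = (m / j) ^ (1 / 2 : ℝ) := by
      rw [Real.rpow_def_of_pos (by positivity)]; congr 1; ring
    rw [e1, e2] at h
    exact h.trans_eq (by ring)
  refine (sum_le_sum hj).trans ?_
  rw [← mul_sum, le_div_iff₀ (by positivity)]
  have hX2 : 2 ≤ ⌊m⌋₊ := Nat.le_floor (by exact_mod_cast hm)
  have hX2' : (2 : ℝ) ≤ ⌊m⌋₊ := by exact_mod_cast hX2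
  have hQm : ∑ q ∈ Icc 1 ⌊m⌋₊ with IsPrimePow q, (q : ℝ)⁻¹ ≤ Real.log (Real.log m) + B := by
    refine (hQ _ hX2).trans ?_
    gcongr
    · exact Real.log_pos (by linarith)
    · exact Nat.floor_le hm0.le
  have hQ0 : 0 ≤ ∑ q ∈ Icc 1 ⌊m⌋₊ with IsPrimePow q, (q : ℝ)⁻¹ :=
    sum_nonneg fun _ _ => by positivity
  have hP := pow_le_pow_left₀ hQ0 hQm a
  have hP0 := pow_nonneg (hQ0.trans hQm) a
  have h1 := hS a m hm
  rw [mul_div_assoc', le_div_iff₀ (by positivity)] at h1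
  have h2 : A * m * (∑ q ∈ Icc 1 ⌊m⌋₊ with IsPrimePow q, (q : ℝ)⁻¹) ^ a ≤
      (A + 1) * m * (Real.log (Real.log m) + B) ^ a := by
    gcongr
    linarith
  calc _ = K * W * ((∑ j ∈ Icc 1 ⌊m⌋₊ with j.primeFactors.card = a + 1,
        (m / j) ^ (1 / 2 : ℝ)) * Real.log m * (a.factorial : ℝ)) := by ring
    _ ≤ K * W * ((A + 1) * m * (Real.log (Real.log m) + B) ^ a) :=
        mul_le_mul_of_nonneg_left (h1.trans h2) (mul_nonneg hK.le hW0)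
    _ = _ := by ring
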